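/- Let α > 1, f ∈ SR_α, b < α, k ∈ SR_b, and let g be the solution of g(Λ)·f′(g(Λ)) − f(g(Λ)) + k(g(Λ)) = ln Λ, defined for Λ larger than some r₀ > 0. Then the following limits hold as Λ → ∞: (1) g′(Λ)·Λ·ln Λ / g(Λ) → 1/α; (2) f(g(Λ))/ln Λ → 1/(α−1); (3) g(Λ)·f′(g(Λ))/ln Λ → α/(α−1); (4) (g(Λ)·f′(g(Λ)) − f(g(Λ)))/ln Λ → 1. -/

import Mathlib

open MeasureTheory Filter Real Set
open scoped Topology BigOperators ENNReal

noncomputable section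

/-- `f` is smoothly regularly varying of index `α`: beyond some `z₀ ≥ 1` it is positive and
infinitely differentiable, and `h u = log (f (exp u))` satisfies `h' → α` and
`h^(m) → 0` for every `m ≥ 2`. -/
def SmoothRegVary (α : ℝ) (f : ℝ → ℝ) : Prop :=
  ∃ z₀ : ℝ, 1 ≤ z₀ ∧ (∀ x, z₀ < x → 0 < f x) ∧
    ContDiffOn ℝ (⊤ : ℕ∞) f (Set.Ioi z₀) ∧
    Filter.Tendsto (deriv (fun u => Real.log (f (Real.exp u)))) Filter.atTop (nhds α) ∧
    ∀ m : ℕ, 2 ≤ m →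
      Filter.Tendsto (iteratedDeriv m (fun u => Real.log (f (Real.exp u))))
        Filter.atTop (nhds 0)

lemma tendsto_atBot_of_tendsto_deriv_neg {w : ℝ → ℝ} {c : ℝ} (hc : c < 0)
    (hw : ∀ᶠ u in atTop, DifferentiableAt ℝ w u) (hd : Tendsto (deriv w) atTop (𝓝 c)) :
    Tendsto w atTop atBot := by
  obtain ⟨A, hA⟩ := eventually_atTop.1 (hw.and (hd.eventually_lt_const (by linarith : c < c / 2)))
  have hlin : Tendsto (fun u => w A + c / 2 * (u - A)) atTop atBot :=
    tendsto_atBot_add_const_left _ _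
      ((tendsto_atTop_add_const_right _ (-A) tendsto_id).const_mul_atTop_of_neg
        (by linarith : c / 2 < 0))
  refine tendsto_atBot_mono' _ ?_ hlin
  filter_upwards [eventually_ge_atTop A] with u hu
  have := (convex_Ici A).image_sub_le_mul_sub_of_deriv_le
    (fun x hx => (hA x hx).1.continuousAt.continuousWithinAt)
    (fun x hx => (hA x (interior_subset hx)).1.differentiableWithinAt)
    (C := c / 2) (fun x hx => (hA x (interior_subset hx)).2.le) A self_mem_Ici u hu hu
  linarith

namespace SmoothRegVary

variable {α b : ℝ} {f k : ℝ → ℝ}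

lemma eventually_pos (hf : SmoothRegVary α f) : ∀ᶠ x in atTop, 0 < f x := by
  obtain ⟨z, -, hpos, -⟩ := hf
  exact (eventually_gt_atTop z).mono hpos

lemma eventually_contDiffAt (hf : SmoothRegVary α f) :
    ∀ᶠ x in atTop, ContDiffAt ℝ (⊤ : ℕ∞) f x := by
  obtain ⟨z, -, -, hsmooth, -⟩ := hf
  exact (eventually_gt_atTop z).mono fun x hx => hsmooth.contDiffAt (Ioi_mem_nhds hx)

lemma eventually_hasDerivAt (hf : SmoothRegVary α f) :
    ∀ᶠ x in atTop, HasDerivAt f (deriv f x) x :=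
  hf.eventually_contDiffAt.mono fun _ hx => (hx.differentiableAt (by simp)).hasDerivAt

lemma eventually_hasDerivAt_deriv (hf : SmoothRegVary α f) :
    ∀ᶠ x in atTop, HasDerivAt (deriv f) (deriv (deriv f) x) x :=
  hf.eventually_contDiffAt.mono fun _ hx =>
    ((hx.derivWithin (m := (1 : ℕ∞)) (mod_cast le_top)).differentiableAt (by simp)).hasDerivAt

lemma eventually_hasDerivAt_log_exp (hf : SmoothRegVary α f) :
    ∀ᶠ u in atTop, HasDerivAt (fun u => log (f (exp u)))
      (exp u * deriv f (exp u) / f (exp u)) u := by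
  filter_upwards [tendsto_exp_atTop.eventually hf.eventually_pos,
    tendsto_exp_atTop.eventually hf.eventually_hasDerivAt] with u hpos hd
  exact ((hd.comp u (hasDerivAt_exp u)).log hpos.ne').congr_deriv
    (by simp only [Function.comp_apply, mul_comm])

lemma tendsto_elasticity (hf : SmoothRegVary α f) :
    Tendsto (fun x => x * deriv f x / f x) atTop (𝓝 α) := by
  obtain ⟨-, -, -, -, hlim, -⟩ := id hf
  have h := (hlim.congr' (hf.eventually_hasDerivAt_log_exp.mono fun u hu => hu.deriv)).comp
    tendsto_log_atTop
  refine h.congr' ?_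
  filter_upwards [eventually_gt_atTop 0] with x hx
  simp only [Function.comp_apply, exp_log hx]

lemma tendsto_sq_mul_deriv_deriv_div (hf : SmoothRegVary α f) :
    Tendsto (fun x => x ^ 2 * deriv (deriv f) x / f x) atTop (𝓝 (α * (α - 1))) := by
  obtain ⟨-, -, -, -, -, hlim⟩ := id hf
  have heq : ∀ᶠ u in atTop, iteratedDeriv 2 (fun u => log (f (exp u))) u =
      exp u ^ 2 * deriv (deriv f) (exp u) / f (exp u) + exp u * deriv f (exp u) / f (exp u)
        - (exp u * deriv f (exp u) / f (exp u)) ^ 2 := by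
    obtain ⟨A, hA⟩ := eventually_atTop.1 hf.eventually_hasDerivAt_log_exp
    filter_upwards [eventually_gt_atTop A, tendsto_exp_atTop.eventually hf.eventually_pos,
      tendsto_exp_atTop.eventually hf.eventually_hasDerivAt,
      tendsto_exp_atTop.eventually hf.eventually_hasDerivAt_deriv] with u hu hpos hd hd2
    have hev : deriv (fun u => log (f (exp u))) =ᶠ[𝓝 u]
        fun u => exp u * deriv f (exp u) / f (exp u) :=
      eventuallyEq_of_mem (Ioi_mem_nhds hu) fun v hv => (hA v (mem_Ioi.1 hv).le).deriv
    have he := hasDerivAt_exp u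
    rw [iteratedDeriv_succ, iteratedDeriv_one, hev.deriv_eq]
    refine ((he.mul (hd2.comp u he)).div (hd.comp u he) hpos.ne').deriv.trans ?_
    simp only [Function.comp_apply, Pi.mul_apply]
    field_simp
    ring
  have h := ((hlim 2 le_rfl).congr' heq).comp tendsto_log_atTop
  have hE := hf.tendsto_elasticity
  have hsum := (h.sub hE).add (hE.pow 2)
  rw [show 0 - α + α ^ 2 = α * (α - 1) by ring] at hsum
  refine hsum.congr' ?_
  filter_upwards [eventually_gt_atTop 0] with x hx
  simp only [Function.comp_apply, exp_log hx]
  ring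

lemma tendsto_div_zero (hf : SmoothRegVary α f) (hk : SmoothRegVary b k) (hb : b < α) :
    Tendsto (fun x => k x / f x) atTop (𝓝 0) := by
  obtain ⟨-, -, -, -, hflim, -⟩ := id hf
  obtain ⟨-, -, -, -, hklim, -⟩ := id hk
  have hw : Tendsto (fun u => log (k (exp u)) - log (f (exp u))) atTop atBot := by
    refine tendsto_atBot_of_tendsto_deriv_neg (sub_neg.2 hb) ?_ ((hklim.sub hflim).congr' ?_)
    · filter_upwards [hf.eventually_hasDerivAt_log_exp, hk.eventually_hasDerivAt_log_exp]
        with u h₁ h₂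
      exact (h₂.sub h₁).differentiableAt
    · filter_upwards [hf.eventually_hasDerivAt_log_exp, hk.eventually_hasDerivAt_log_exp]
        with u h₁ h₂
      rw [h₁.deriv, h₂.deriv]
      exact (h₂.sub h₁).deriv.symm
  refine (tendsto_exp_atBot.comp (hw.comp tendsto_log_atTop)).congr' ?_
  filter_upwards [eventually_gt_atTop 0, hf.eventually_pos, hk.eventually_pos] with x hx h₁ h₂
  simp only [Function.comp_apply, exp_log hx, exp_sub, exp_log h₁, exp_log h₂]

end SmoothRegVary

/-- Lemma 2.6(iii): asymptotic behavior of the solution `g` of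
`g(Λ) f'(g(Λ)) - f(g(Λ)) + k(g(Λ)) = ln Λ`. -/
theorem stmt6 {α b : ℝ} (hα : 1 < α) (hb : b < α) {f k : ℝ → ℝ}
    (hf : SmoothRegVary α f) (hk : SmoothRegVary b k)
    (r₀ : ℝ) (hr₀ : 0 < r₀) (g : ℝ → ℝ)
    (hgtop : Filter.Tendsto g Filter.atTop Filter.atTop)
    (hgdiff : ∀ Λ : ℝ, r₀ < Λ → DifferentiableAt ℝ g Λ)
    (hg : ∀ Λ : ℝ, r₀ < Λ →
      g Λ * deriv f (g Λ) - f (g Λ) + k (g Λ) = Real.log Λ) :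
    Filter.Tendsto (fun Λ : ℝ => deriv g Λ * Λ * Real.log Λ / g Λ)
        Filter.atTop (nhds α⁻¹) ∧
    Filter.Tendsto (fun Λ : ℝ => f (g Λ) / Real.log Λ)
        Filter.atTop (nhds ((α - 1)⁻¹)) ∧
    Filter.Tendsto (fun Λ : ℝ => g Λ * deriv f (g Λ) / Real.log Λ)
        Filter.atTop (nhds (α / (α - 1))) ∧
    Filter.Tendsto (fun Λ : ℝ => (g Λ * deriv f (g Λ) - f (g Λ)) / Real.log Λ)
        Filter.atTop (nhds 1) := by
  have hα' : α - 1 ≠ 0 := (sub_pos.2 hα).ne'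
  have hkf := hf.tendsto_div_zero hk hb
  have hE := hf.tendsto_elasticity
  have hkd : Tendsto (fun x => x * deriv k x / f x) atTop (𝓝 0) := by
    have h := hk.tendsto_elasticity.mul hkf
    rw [mul_zero] at h
    refine h.congr' ?_
    filter_upwards [hk.eventually_pos] with x hx
    field_simp
  have hlogf : Tendsto (fun Λ => log Λ / f (g Λ)) atTop (𝓝 (α - 1)) := by
    have h := ((hE.sub_const 1).add hkf).comp hgtop
    rw [add_zero] at h
    refine h.congr' ?_
    filter_upwards [eventually_gt_atTop r₀, hgtop.eventually hf.eventually_pos] with Λ hΛ hpos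
    simp only [Function.comp_apply, ← hg Λ hΛ]
    field_simp
  have hflog : Tendsto (fun Λ => f (g Λ) / log Λ) atTop (𝓝 ((α - 1)⁻¹)) :=
    (hlogf.inv₀ hα').congr fun Λ => inv_div _ _
  have hdlog : Tendsto (fun Λ => g Λ * deriv f (g Λ) / log Λ) atTop (𝓝 (α / (α - 1))) := by
    refine ((hE.comp hgtop).mul hflog).congr' ?_
    filter_upwards [hgtop.eventually hf.eventually_pos] with Λ hpos
    simp only [Function.comp_apply]
    field_simp
  refine ⟨?_, hflog, hdlog, ?_⟩
  · have h := (((hf.tendsto_sq_mul_deriv_deriv_div.add hkd).comp hgtop).mul hflog).inv₀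
      (by simp only [add_zero]; rw [mul_assoc, mul_inv_cancel₀ hα']; linarith)
    rw [add_zero, mul_assoc, mul_inv_cancel₀ hα', mul_one] at h
    refine h.congr' ?_
    filter_upwards [eventually_gt_atTop r₀, eventually_gt_atTop 1, hgtop.eventually_gt_atTop 0,
      hgtop.eventually hf.eventually_pos, hgtop.eventually hf.eventually_hasDerivAt,
      hgtop.eventually hf.eventually_hasDerivAt_deriv,
      hgtop.eventually hk.eventually_hasDerivAt] with Λ hΛ hΛ1 hgpos hfpos hfd hfd2 hkd
    have hlog := log_pos hΛ1
    have hgd := (hgdiff Λ hΛ).hasDerivAt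
    have hlhs := ((hgd.mul (hfd2.comp Λ hgd)).sub (hfd.comp Λ hgd)).add (hkd.comp Λ hgd)
    have hrhs := (hasDerivAt_log (zero_lt_one.trans hΛ1).ne').congr_of_eventuallyEq
      (eventuallyEq_of_mem (Ioi_mem_nhds hΛ) hg)
    have hderiv := hlhs.unique hrhs
    simp only [Function.comp_apply] at hderiv
    have hone : deriv g Λ * Λ * (g Λ * deriv (deriv f) (g Λ) + deriv k (g Λ)) = 1 := by
      have hΛ0 : Λ ≠ 0 := by linarith
      rw [← mul_inv_cancel₀ hΛ0, ← hderiv]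
      ring
    refine inv_eq_of_mul_eq_one_left ?_
    simp only [Function.comp_apply]
    rw [← hone]
    field_simp
  · have h := hdlog.sub hflog
    rw [show α / (α - 1) - (α - 1)⁻¹ = 1 by field_simp] at h
    exact h.congr fun Λ => (sub_div _ _ _).symm
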